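/- Let G be an undirected graph on N vertices, let k > N, and let P(G,k) be the vertex-cover DAG of G with parameter k. Then P(G,k) admits a valid pebbling with R = k + 1 red pebbles in the oneshot model of cost at most 2·(k − N)·τ(G) + 2N², where τ(G) denotes the minimum size of a vertex cover of G. -/

import Mathlib

namespace RBPebble

open scoped Classical

/-- A pebble is either red (fast memory) or blue (slow memory). -/
inductive Peb : Type
  | red
  | blue
  deriving DecidableEq

/-- The four kinds of moves of a red-blue pebbling. -/
inductive Move (V : Type) : Type
  | toRed (v : V)    -- (1) replace a blue pebble by a red pebble
  | toBlue (v : V)   -- (2) replace a red pebble by a blue pebble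
  | compute (v : V)  -- (3) place a red pebble on a node whose in-neighbors are all red
  | delete (v : V)   -- (4) delete a pebble
  deriving DecidableEq

variable {V : Type}

/-- A configuration assigns to each node no pebble, a red pebble, or a blue pebble. -/
def Config (V : Type) : Type := V → Option Peb

/-- The initial configuration: no pebbles anywhere. -/
def initConfig : Config V := fun _ => none

/-- The effect of a move on a configuration. -/
def applyMove [DecidableEq V] (c : Config V) : Move V → Config V
  | .toRed v => Function.update c v (some Peb.red)
  | .toBlue v => Function.update c v (some Peb.blue)
  | .compute v => Function.update c v (some Peb.red)
  | .delete v => Function.update c v none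

/-- The number of red pebbles in a configuration. -/
noncomputable def redCount [Fintype V] (c : Config V) : ℕ :=
  (Finset.univ.filter fun v => c v = some Peb.red).card

/-- Legality of a move in a given configuration (base model). -/
def legalMove (edge : V → V → Prop) (c : Config V) : Move V → Prop
  | .toRed v => c v = some Peb.blue
  | .toBlue v => c v = some Peb.red
  | .compute v => ∀ u, edge u v → c u = some Peb.red
  | .delete v => c v ≠ none

/-- A sequence of moves is valid from a configuration: every move is legal and
at every point at most `R` red pebbles are on the graph. -/
def ValidFrom [Fintype V] [DecidableEq V] (edge : V → V → Prop) (R : ℕ) :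
    Config V → List (Move V) → Prop
  | _, [] => True
  | c, m :: ms =>
      legalMove edge c m ∧ redCount (applyMove c m) ≤ R ∧
        ValidFrom edge R (applyMove c m) ms

/-- Running a list of moves from a configuration. -/
def runMoves [DecidableEq V] (c : Config V) : List (Move V) → Config V
  | [] => c
  | m :: ms => runMoves (applyMove c m) ms

/-- A sink: a node with no outgoing edge. -/
def IsSink (edge : V → V → Prop) (v : V) : Prop := ∀ u, ¬ edge v u

/-- A source: a node with no incoming edge. -/
def IsSource (edge : V → V → Prop) (v : V) : Prop := ∀ u, ¬ edge u v

/-- A valid pebbling of the DAG with `R` red pebbles: starts from the empty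
configuration, is valid throughout, and in the final configuration every sink
carries a pebble (of either color). -/
def IsPebbling [Fintype V] [DecidableEq V] (edge : V → V → Prop) (R : ℕ)
    (moves : List (Move V)) : Prop :=
  ValidFrom edge R initConfig moves ∧
    ∀ v, IsSink edge v → runMoves initConfig moves v ≠ none

def isTransfer : Move V → Bool
  | .toRed _ => true
  | .toBlue _ => true
  | _ => false

def isCompute : Move V → Bool
  | .compute _ => true
  | _ => false

def isDelete : Move V → Bool
  | .delete _ => true
  | _ => false

/-- The cost of a pebbling: the number of moves of types (1) and (2). -/
def cost (moves : List (Move V)) : ℕ := (moves.filter isTransfer).length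

/-- The number of compute moves (type (3)). -/
def computeCount (moves : List (Move V)) : ℕ := (moves.filter isCompute).length

/-- The number of delete moves (type (4)). -/
def deleteCount (moves : List (Move V)) : ℕ := (moves.filter isDelete).length

/-- The cost in the compcost model: transfers plus `ε` times the computes. -/
noncomputable def ccCost (ε : ℝ) (moves : List (Move V)) : ℝ :=
  (cost moves : ℝ) + ε * (computeCount moves : ℝ)

/-- The oneshot restriction: each node is computed at most once. -/
def Oneshot [DecidableEq V] (moves : List (Move V)) : Prop :=
  ∀ v : V, moves.count (Move.compute v) ≤ 1

/-- The nodel restriction: no delete moves are used. -/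
def NoDel (moves : List (Move V)) : Prop := ∀ m ∈ moves, isDelete m = false

/-- The indegree of a node. -/
noncomputable def indeg [Fintype V] (edge : V → V → Prop) (v : V) : ℕ :=
  (Finset.univ.filter fun u => edge u v).card

/-- The edge relation is acyclic (the graph is a DAG). -/
def Acyclic (edge : V → V → Prop) : Prop :=
  ∀ v, ¬ Relation.TransGen edge v v

/-- The optimal cost of a valid pebbling with `R` red pebbles in the oneshot model. -/
noncomputable def optCost [Fintype V] [DecidableEq V] (edge : V → V → Prop) (R : ℕ) : ℕ :=
  sInf {c | ∃ moves : List (Move V),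
    IsPebbling edge R moves ∧ Oneshot moves ∧ cost moves = c}

/-- The node type of the vertex-cover DAG `P(G,k)` of an undirected graph
`G = (Fin N, adj)` with parameter `k > N`. The five summands are, in order:
the common source nodes (`C_a` has the `k − N` nodes `(a, j)`); the first-level
target nodes `t_{a,1,b}` (pairs `(a, b)` with `b ≠ a`); the second-level target
nodes `t_{a,2}`; the `N` fresh filler source nodes of each first-level group
`V_{a,1}`; and the `N − deg(a)` fresh filler source nodes of each second-level
group `V_{a,2}` (pairs `(a, b)` with `b` not adjacent to `a`). -/
abbrev VCNode (N k : ℕ) (adj : Fin N → Fin N → Prop) : Type :=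
  (Fin N × Fin (k - N)) ⊕
    ({p : Fin N × Fin N // p.1 ≠ p.2} ⊕
      (Fin N ⊕
        ((Fin N × Fin N) ⊕ {p : Fin N × Fin N // ¬ adj p.1 p.2})))

/-- Membership in the first-level input group `V_{a,1}`: the `k − N` common
nodes of `a` together with the `N` first-level fillers of `a` (a set of size
`k`). -/
def inGroup1 {N k : ℕ} {adj : Fin N → Fin N → Prop} (a : Fin N) :
    VCNode N k adj → Prop
  | Sum.inl q => q.1 = a
  | Sum.inr (Sum.inr (Sum.inr (Sum.inl q))) => q.1 = a
  | _ => False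

/-- Membership in the second-level input group `V_{a,2}`: the `k − N` common
nodes of `a`, the first-level targets `t_{b,1,a}` for every edge `{a,b}` of
`G`, and the second-level fillers of `a` (a set of size `k`). -/
def inGroup2 {N k : ℕ} {adj : Fin N → Fin N → Prop} (a : Fin N) :
    VCNode N k adj → Prop
  | Sum.inl q => q.1 = a
  | Sum.inr (Sum.inl p) => p.val.2 = a ∧ adj a p.val.1
  | Sum.inr (Sum.inr (Sum.inr (Sum.inr p))) => p.val.1 = a
  | _ => False

/-- The edge relation of `P(G,k)`: the in-neighbor set of each first-level
target `t_{a,1,b}` is exactly `V_{a,1}`, and the in-neighbor set of each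
second-level target `t_{a,2}` is exactly `V_{a,2}`. -/
def vcEdge (N k : ℕ) (adj : Fin N → Fin N → Prop) :
    VCNode N k adj → VCNode N k adj → Prop := fun u v =>
  match v with
  | Sum.inr (Sum.inl p) => inGroup1 p.val.1 u
  | Sum.inr (Sum.inr (Sum.inl a)) => inGroup2 a u
  | _ => False

/-- A vertex cover of `G`: a set of vertices meeting every edge. -/
def IsVertexCover {N : ℕ} (adj : Fin N → Fin N → Prop)
    (S : Finset (Fin N)) : Prop :=
  ∀ a b, adj a b → a ∈ S ∨ b ∈ S

/-- `τ(G)`: the minimum size of a vertex cover of `G`. -/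
noncomputable def vcNumber {N : ℕ} (adj : Fin N → Fin N → Prop) : ℕ :=
  sInf {m | ∃ S : Finset (Fin N), IsVertexCover adj S ∧ S.card = m}

/-! ### Reachable configurations -/

theorem update_config_apply [DecidableEq V] (c : Config V) (v : V) (p : Option Peb) (w : V) :
    (Function.update c v p : Config V) w = if w = v then p else c w :=
  Function.update_apply c v p w

theorem validFrom_append [Fintype V] [DecidableEq V] (edge : V → V → Prop) (R : ℕ)
    (ms ms' : List (Move V)) (c : Config V) :
    ValidFrom edge R c (ms ++ ms') ↔
      ValidFrom edge R c ms ∧ ValidFrom edge R (runMoves c ms) ms' := by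
  induction ms generalizing c with
  | nil => simp [ValidFrom, runMoves]
  | cons m ms ih => simp [ValidFrom, runMoves, ih, and_assoc]

theorem runMoves_append [DecidableEq V] (ms ms' : List (Move V)) (c : Config V) :
    runMoves c (ms ++ ms') = runMoves (runMoves c ms) ms' := by
  induction ms generalizing c with
  | nil => rfl
  | cons m ms ih => exact ih _

theorem redCount_eq_ncard [Fintype V] {c : Config V} {A : Set V}
    (h : ∀ v, c v = some Peb.red ↔ v ∈ A) : redCount c = A.ncard := by
  rw [redCount, ← Set.ncard_coe_finset]
  congr 1
  ext v
  simp [h]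

theorem ValidFrom.redCount_runMoves_le [Fintype V] [DecidableEq V] {edge : V → V → Prop} {R : ℕ}
    {ms : List (Move V)} {c : Config V} (h : ValidFrom edge R c ms) (hc : redCount c ≤ R) :
    redCount (runMoves c ms) ≤ R := by
  induction ms generalizing c with
  | nil => exact hc
  | cons m ms ih => exact ih h.2.2 h.2.1

/-- Some valid oneshot sequence of moves of cost at most `n` computes only nodes of `D` and leads
from the empty configuration to the one with red pebbles on `A` and blue pebbles on `B`. -/
def Reach [Fintype V] [DecidableEq V] (edge : V → V → Prop) (R : ℕ) (A B D : Set V) (n : ℕ) :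
    Prop :=
  ∃ ms : List (Move V), ValidFrom edge R initConfig ms ∧
    (∀ v, runMoves initConfig ms v = some Peb.red ↔ v ∈ A) ∧
    (∀ v, runMoves initConfig ms v = some Peb.blue ↔ v ∈ B) ∧
    Oneshot ms ∧ (∀ v, Move.compute v ∈ ms → v ∈ D) ∧ cost ms ≤ n

namespace Reach

variable [Fintype V] [DecidableEq V] {edge : V → V → Prop} {R : ℕ} {A B D : Set V} {n : ℕ}

theorem empty (edge : V → V → Prop) (R : ℕ) : Reach edge R ∅ ∅ ∅ 0 :=
  ⟨[], by simp [ValidFrom, runMoves, initConfig, Oneshot, cost]⟩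

theorem mono {m : ℕ} (h : Reach edge R A B D n) (hm : n ≤ m) : Reach edge R A B D m := by
  obtain ⟨ms, h1, h2, h3, h4, h5, h6⟩ := h
  exact ⟨ms, h1, h2, h3, h4, h5, h6.trans hm⟩

theorem disjoint (h : Reach edge R A B D n) : Disjoint A B := by
  obtain ⟨ms, -, h2, h3, -⟩ := h
  refine Set.disjoint_left.2 fun v hA hB => ?_
  have := (h2 v).2 hA
  rw [(h3 v).2 hB] at this
  simp at this

theorem ncard_le (h : Reach edge R A B D n) : A.ncard ≤ R := by
  obtain ⟨ms, h1, h2, -⟩ := h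
  rw [← redCount_eq_ncard h2]
  exact h1.redCount_runMoves_le (by simp [redCount, initConfig])

theorem compute_one (h : Reach edge R A B D n) {v : V} (hD : v ∉ D) (hB : v ∉ B)
    (hin : ∀ u, edge u v → u ∈ A) (hR : (insert v A).ncard ≤ R) :
    Reach edge R (insert v A) B (insert v D) n := by
  obtain ⟨ms, h1, h2, h3, h4, h5, h6⟩ := h
  have hred : ∀ w, applyMove (runMoves initConfig ms) (.compute v) w = some Peb.red ↔
      w ∈ insert v A := fun w => by
    by_cases hw : w = v
    · simp [applyMove, update_config_apply, hw]
    · simp [applyMove, update_config_apply, hw, h2]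
  refine ⟨ms ++ [.compute v], ?_, ?_, fun w => ?_, fun w => ?_, fun w hw => ?_, ?_⟩
  · rw [validFrom_append]
    exact ⟨h1, fun u hu => (h2 u).2 (hin u hu), (redCount_eq_ncard hred).trans_le hR, trivial⟩
  · simpa [runMoves_append, runMoves] using hred
  · rw [runMoves_append]
    by_cases hw : w = v
    · simp [runMoves, applyMove, update_config_apply, hw, hB]
    · simp [runMoves, applyMove, update_config_apply, hw, h3]
  · by_cases hw : w = v
    · have : ms.count (.compute v) = 0 := List.count_eq_zero.2 fun hm => hD (h5 v hm)
      subst hw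
      simp [this]
    · have := h4 w
      simpa [List.count_append, List.count_singleton, Ne.symm hw] using this
  · simp only [List.mem_append, List.mem_singleton, Move.compute.injEq] at hw
    exact hw.elim (fun hm => Or.inr (h5 w hm)) Or.inl
  · simpa [cost, List.filter_cons, isTransfer] using h6

theorem load_one (h : Reach edge R A B D n) {v : V} (hB : v ∈ B)
    (hR : (insert v A).ncard ≤ R) : Reach edge R (insert v A) (B \ {v}) D (n + 1) := by
  obtain ⟨ms, h1, h2, h3, h4, h5, h6⟩ := h
  have hred : ∀ w, applyMove (runMoves initConfig ms) (.toRed v) w = some Peb.red ↔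
      w ∈ insert v A := fun w => by
    by_cases hw : w = v
    · simp [applyMove, update_config_apply, hw]
    · simp [applyMove, update_config_apply, hw, h2]
  refine ⟨ms ++ [.toRed v], ?_, ?_, fun w => ?_, fun w => ?_, fun w hw => ?_, ?_⟩
  · rw [validFrom_append]
    exact ⟨h1, (h3 v).2 hB, (redCount_eq_ncard hred).trans_le hR, trivial⟩
  · simpa [runMoves_append, runMoves] using hred
  · rw [runMoves_append]
    by_cases hw : w = v
    · simp [runMoves, applyMove, update_config_apply, hw]
    · simp [runMoves, applyMove, update_config_apply, hw, h3]
  · simpa [List.count_append, List.count_singleton] using h4 w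
  · exact h5 w (by simpa using hw)
  · simpa [cost, List.filter_cons, isTransfer] using h6

theorem store_one (h : Reach edge R A B D n) {v : V} (hA : v ∈ A) :
    Reach edge R (A \ {v}) (insert v B) D (n + 1) := by
  have hR := h.ncard_le
  obtain ⟨ms, h1, h2, h3, h4, h5, h6⟩ := h
  have hred : ∀ w, applyMove (runMoves initConfig ms) (.toBlue v) w = some Peb.red ↔
      w ∈ A \ {v} := fun w => by
    by_cases hw : w = v
    · simp [applyMove, update_config_apply, hw]
    · simp [applyMove, update_config_apply, hw, h2]
  refine ⟨ms ++ [.toBlue v], ?_, ?_, fun w => ?_, fun w => ?_, fun w hw => ?_, ?_⟩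
  · rw [validFrom_append]
    exact ⟨h1, (h2 v).2 hA, (redCount_eq_ncard hred).trans_le
      ((Set.ncard_le_ncard Set.sdiff_subset).trans hR), trivial⟩
  · simpa [runMoves_append, runMoves] using hred
  · rw [runMoves_append]
    by_cases hw : w = v
    · simp [runMoves, applyMove, update_config_apply, hw]
    · simp [runMoves, applyMove, update_config_apply, hw, h3]
  · simpa [List.count_append, List.count_singleton] using h4 w
  · exact h5 w (by simpa using hw)
  · simpa [cost, List.filter_cons, isTransfer] using h6

theorem delete_one (h : Reach edge R A B D n) {v : V} (hA : v ∈ A) :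
    Reach edge R (A \ {v}) B D n := by
  have hR := h.ncard_le
  have hB : v ∉ B := Set.disjoint_left.1 h.disjoint hA
  obtain ⟨ms, h1, h2, h3, h4, h5, h6⟩ := h
  have hred : ∀ w, applyMove (runMoves initConfig ms) (.delete v) w = some Peb.red ↔
      w ∈ A \ {v} := fun w => by
    by_cases hw : w = v
    · simp [applyMove, update_config_apply, hw]
    · simp [applyMove, update_config_apply, hw, h2]
  refine ⟨ms ++ [.delete v], ?_, ?_, fun w => ?_, fun w => ?_, fun w hw => ?_, ?_⟩
  · rw [validFrom_append]
    exact ⟨h1, by simp [legalMove, (h2 v).2 hA], (redCount_eq_ncard hred).trans_le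
      ((Set.ncard_le_ncard Set.sdiff_subset).trans hR), trivial⟩
  · simpa [runMoves_append, runMoves] using hred
  · rw [runMoves_append]
    by_cases hw : w = v
    · simp [runMoves, applyMove, update_config_apply, hw, hB]
    · simp [runMoves, applyMove, update_config_apply, hw, h3]
  · simpa [List.count_append, List.count_singleton] using h4 w
  · exact h5 w (by simpa using hw)
  · simpa [cost, List.filter_cons, isTransfer] using h6

theorem compute (h : Reach edge R A B D n) (s : Set V) (hD : Disjoint s D) (hB : Disjoint s B)
    (hin : ∀ v ∈ s, ∀ u, edge u v → u ∈ A) (hR : (A ∪ s).ncard ≤ R) :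
    Reach edge R (A ∪ s) B (D ∪ s) n := by
  induction s, s.toFinite using Set.Finite.induction_on with
  | empty => simpa using h
  | @insert v s hv _ ih =>
    rw [Set.disjoint_insert_left] at hD hB
    rw [Set.union_insert] at hR
    have := (ih hD.2 hB.2 (fun w hw => hin w (Or.inr hw))
      ((Set.ncard_le_ncard (Set.subset_insert _ _)).trans hR)).compute_one (v := v)
      (by simp [hD.1, hv]) hB.1 (fun u hu => Or.inl (hin v (Or.inl rfl) u hu)) hR
    simpa only [Set.union_insert] using this

theorem load (h : Reach edge R A B D n) (s : Set V) (hB : s ⊆ B) (hR : (A ∪ s).ncard ≤ R) :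
    Reach edge R (A ∪ s) (B \ s) D (n + s.ncard) := by
  induction s, s.toFinite using Set.Finite.induction_on with
  | empty => simpa using h
  | @insert v s hv _ ih =>
    rw [Set.insert_subset_iff] at hB
    rw [Set.union_insert] at hR
    have := (ih hB.2 ((Set.ncard_le_ncard (Set.subset_insert _ _)).trans hR)).load_one (v := v)
      ⟨hB.1, hv⟩ hR
    rw [Set.ncard_insert_of_notMem hv, Set.union_insert, ← add_assoc]
    convert this using 1
    ext; simp; tauto

theorem store (h : Reach edge R A B D n) (s : Set V) (hA : s ⊆ A) :
    Reach edge R (A \ s) (B ∪ s) D (n + s.ncard) := by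
  induction s, s.toFinite using Set.Finite.induction_on with
  | empty => simpa using h
  | @insert v s hv _ ih =>
    rw [Set.insert_subset_iff] at hA
    have := (ih hA.2).store_one (v := v) ⟨hA.1, hv⟩
    rw [Set.ncard_insert_of_notMem hv, Set.union_insert, ← add_assoc]
    convert this using 1
    ext; simp; tauto

theorem delete (h : Reach edge R A B D n) (s : Set V) (hA : s ⊆ A) :
    Reach edge R (A \ s) B D n := by
  induction s, s.toFinite using Set.Finite.induction_on with
  | empty => simpa using h
  | @insert v s hv _ ih =>
    rw [Set.insert_subset_iff] at hA
    convert (ih hA.2).delete_one (v := v) ⟨hA.1, hv⟩ using 1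
    ext; simp; tauto

/-- Compute the nodes of `s` one by one, moving each to slow memory before the next. -/
theorem compute_store (h : Reach edge R A B D n) (s : Set V) (hD : Disjoint s D)
    (hB : Disjoint s B) (hA : Disjoint s A) (hin : ∀ v ∈ s, ∀ u, edge u v → u ∈ A)
    (hR : A.ncard + 1 ≤ R) : Reach edge R A (B ∪ s) (D ∪ s) (n + s.ncard) := by
  induction s, s.toFinite using Set.Finite.induction_on with
  | empty => simpa using h
  | @insert v s hv _ ih =>
    rw [Set.disjoint_insert_left] at hD hB hA
    have := ((ih hD.2 hB.2 hA.2 (fun w hw => hin w (Or.inr hw))).compute_one (v := v)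
      (by simp [hD.1, hv]) (by simp [hB.1, hv]) (hin v (Or.inl rfl))
      ((Set.ncard_insert_le _ _).trans hR)).store_one (Or.inl rfl)
    rw [Set.ncard_insert_of_notMem hv, ← add_assoc]
    simpa [Set.union_insert, hA.1] using this

end Reach

/-! ### Pebbling the vertex-cover DAG -/

section VertexCoverDAG

variable {N k : ℕ} {adj : Fin N → Fin N → Prop}

/-- The set of the nodes `C_a`, `t_{a,1,b}`, `t_{a,2}`, first-level fillers and second-level
fillers whose indices satisfy the respective one of the five given predicates. -/
def nodeSet (k : ℕ) (adj : Fin N → Fin N → Prop) (C : Fin N → Prop) (T : Fin N → Fin N → Prop)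
    (U F₁ F₂ : Fin N → Prop) : Set (VCNode N k adj) :=
  {v | match v with
    | Sum.inl q => C q.1
    | Sum.inr (Sum.inl p) => T p.val.1 p.val.2
    | Sum.inr (Sum.inr (Sum.inl a)) => U a
    | Sum.inr (Sum.inr (Sum.inr (Sum.inl q))) => F₁ q.1
    | Sum.inr (Sum.inr (Sum.inr (Sum.inr p))) => F₂ p.val.1}

/-- The blue nodes once the vertices of `P₁` and `P₂` have been processed on the first and second
level and the common nodes of `L` have been stored. For `N = 1` the first-level fillers are sinks,
so they are stored as well. -/
def blueSet (k : ℕ) (adj : Fin N → Fin N → Prop) (L P₁ P₂ : Set (Fin N)) :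
    Set (VCNode N k adj) :=
  nodeSet k adj (· ∈ L) (fun a b => a ∈ P₁ ∧ ¬ (b ∈ P₂ ∧ adj b a)) (· ∈ P₂)
    (fun a => N = 1 ∧ a ∈ P₁) (fun _ => False)

/-- The nodes computed once the vertices of `P₁` and `P₂` have been processed on the first and
second level. -/
def doneSet (k : ℕ) (adj : Fin N → Fin N → Prop) (P₁ P₂ : Set (Fin N)) :
    Set (VCNode N k adj) :=
  nodeSet k adj (· ∈ P₁) (fun a _ => a ∈ P₁) (· ∈ P₂) (· ∈ P₁) (· ∈ P₂)

/-- The common nodes `C_a`. -/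
def commonSet (k : ℕ) (adj : Fin N → Fin N → Prop) (a : Fin N) : Set (VCNode N k adj) :=
  nodeSet k adj (· = a) (fun _ _ => False) (fun _ => False) (fun _ => False) (fun _ => False)

theorem ncard_le_of_subset_range {α ι : Type} [Fintype ι] {s : Set α} (f : ι → α)
    (h : s ⊆ Set.range f) : s.ncard ≤ Fintype.card ι := by
  refine (Set.ncard_le_ncard h (Set.finite_range f)).trans ?_
  rw [← Set.image_univ, ← Nat.card_eq_fintype_card, ← Set.ncard_univ]
  exact Set.ncard_image_le Set.finite_univ

theorem ncard_commonSet_le (a : Fin N) : (commonSet k adj a).ncard ≤ k - N := by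
  refine (ncard_le_of_subset_range (fun j : Fin (k - N) => Sum.inl (a, j)) ?_).trans_eq
    (Fintype.card_fin _)
  rintro (⟨b, j⟩ | ⟨p, hp⟩ | b | q | ⟨p, hp⟩) h <;> simp_all [commonSet, nodeSet]

theorem ncard_inGroup1_le (hk : N < k) (a : Fin N) :
    {v : VCNode N k adj | inGroup1 a v}.ncard ≤ k := by
  refine (ncard_le_of_subset_range (Sum.elim (fun j : Fin (k - N) => Sum.inl (a, j))
    (fun b : Fin N => Sum.inr (Sum.inr (Sum.inr (Sum.inl (a, b)))))) ?_).trans_eq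
    (by simp; omega)
  rintro (⟨b, j⟩ | ⟨p, hp⟩ | b | q | ⟨p, hp⟩) h <;> simp_all [inGroup1]
  exact ⟨q.2, by simp [← h]⟩

theorem ncard_inGroup2_le (hk : N < k) (hirr : ∀ a, ¬ adj a a) (a : Fin N) :
    {v : VCNode N k adj | inGroup2 a v}.ncard ≤ k := by
  refine (ncard_le_of_subset_range (Sum.elim (fun j : Fin (k - N) => Sum.inl (a, j))
    (fun b : Fin N => if h : adj a b then
      Sum.inr (Sum.inl ⟨(b, a), fun e : b = a => hirr a (e ▸ h)⟩) else
      Sum.inr (Sum.inr (Sum.inr (Sum.inr ⟨(a, b), h⟩))))) ?_).trans_eq (by simp; omega)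
  rintro (⟨b, j⟩ | ⟨⟨p, q⟩, hp⟩ | b | q | ⟨⟨p, q⟩, hp⟩) h
  · exact ⟨Sum.inl j, by simp_all [inGroup2]⟩
  · obtain ⟨rfl, h⟩ : q = a ∧ adj a p := h
    exact ⟨Sum.inr p, by simp [h]⟩
  · exact h.elim
  · exact h.elim
  · obtain rfl : p = a := h
    exact ⟨Sum.inr q, by simp_all⟩

set_option maxHeartbeats 1000000 in
theorem Reach.first_level [DecidableRel adj] (hk : N < k) {L P₁ P₂ : Set (Fin N)} {n : ℕ}
    (h : Reach (vcEdge N k adj) (k + 1) ∅ (blueSet k adj L P₁ P₂) (doneSet k adj P₁ P₂) n)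
    {a : Fin N} (hL : a ∉ L) (ha : a ∉ P₁) (hP₂ : ∀ b ∈ P₂, ¬ adj b a) :
    Reach (vcEdge N k adj) (k + 1) (commonSet k adj a) (blueSet k adj L (insert a P₁) P₂)
      (doneSet k adj (insert a P₁) P₂) (n + N) := by
  have hcard := ncard_inGroup1_le (adj := adj) hk a
  let T : Set (VCNode N k adj) := nodeSet k adj (fun _ => False) (fun b _ => b = a)
    (fun _ => False) (fun _ => False) (fun _ => False)
  let F : Set (VCNode N k adj) := nodeSet k adj (fun _ => False) (fun _ _ => False)
    (fun _ => False) (fun b => N = 1 ∧ b = a) (fun _ => False)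
  let F' : Set (VCNode N k adj) := nodeSet k adj (fun _ => False) (fun _ _ => False)
    (fun _ => False) (fun b => N ≠ 1 ∧ b = a) (fun _ => False)
  have hTF : T.ncard + F.ncard ≤ N := by
    rw [← Set.ncard_union_eq]
    · refine (ncard_le_of_subset_range (fun b : Fin N => if h : a ≠ b then
        Sum.inr (Sum.inl ⟨(a, b), h⟩) else Sum.inr (Sum.inr (Sum.inr (Sum.inl (a, b))))) ?_).trans_eq
        (Fintype.card_fin _)
      rintro (⟨b, j⟩ | ⟨⟨p, q⟩, hp⟩ | b | ⟨p, q⟩ | ⟨⟨p, q⟩, hp⟩) h <;>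
        simp only [T, F, nodeSet, Set.mem_union, Set.mem_ofPred_eq, or_false, false_or] at h
      · subst h
        exact ⟨q, by simp_all⟩
      · obtain ⟨rfl, rfl⟩ := h
        exact ⟨q, by simp [Subsingleton.elim p q]⟩
    · refine Set.disjoint_left.2 ?_
      rintro (⟨b, j⟩ | ⟨⟨p, q⟩, hp⟩ | b | q | ⟨⟨p, q⟩, hp⟩) <;> simp [T, F, nodeSet]
  have h₁ := h.compute {v | inGroup1 a v}
    (by
      refine Set.disjoint_left.2 ?_
      rintro (⟨b, j⟩ | ⟨⟨p, q⟩, hp⟩ | b | q | ⟨⟨p, q⟩, hp⟩) <;>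
        simp +contextual [inGroup1, doneSet, nodeSet, ha])
    (by
      refine Set.disjoint_left.2 ?_
      rintro (⟨b, j⟩ | ⟨⟨p, q⟩, hp⟩ | b | q | ⟨⟨p, q⟩, hp⟩) <;>
        simp +contextual [inGroup1, blueSet, nodeSet, ha, hL])
    (by
      rintro (⟨b, j⟩ | ⟨⟨p, q⟩, hp⟩ | b | q | ⟨⟨p, q⟩, hp⟩) <;> simp [inGroup1, vcEdge])
    (by rw [Set.empty_union]; omega)
  rw [Set.empty_union] at h₁
  have h₂ := h₁.compute_store T
    (by
      refine Set.disjoint_left.2 ?_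
      rintro (⟨b, j⟩ | ⟨⟨p, q⟩, hp⟩ | b | q | ⟨⟨p, q⟩, hp⟩) <;>
        simp +contextual [T, inGroup1, doneSet, nodeSet, ha])
    (by
      refine Set.disjoint_left.2 ?_
      rintro (⟨b, j⟩ | ⟨⟨p, q⟩, hp⟩ | b | q | ⟨⟨p, q⟩, hp⟩) <;>
        simp +contextual [T, blueSet, nodeSet, ha])
    (by
      refine Set.disjoint_left.2 ?_
      rintro (⟨b, j⟩ | ⟨⟨p, q⟩, hp⟩ | b | q | ⟨⟨p, q⟩, hp⟩) <;> simp [T, inGroup1, nodeSet])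
    (by
      rintro (⟨b, j⟩ | ⟨⟨p, q⟩, hp⟩ | b | q | ⟨⟨p, q⟩, hp⟩) <;>
        simp +contextual [T, nodeSet, vcEdge])
    (by omega)
  have h₃ := h₂.store F (by
    rintro (⟨b, j⟩ | ⟨⟨p, q⟩, hp⟩ | b | q | ⟨⟨p, q⟩, hp⟩) <;> simp [F, inGroup1, nodeSet])
  have h₄ := h₃.delete F' (by
    rintro (⟨b, j⟩ | ⟨⟨p, q⟩, hp⟩ | b | q | ⟨⟨p, q⟩, hp⟩) <;>
      simp +contextual [F, F', inGroup1, nodeSet])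
  convert h₄.mono (m := n + N) (by omega) using 1
  · ext (⟨b, j⟩ | ⟨⟨p, q⟩, hp⟩ | b | q | ⟨⟨p, q⟩, hp⟩) <;>
      simp [commonSet, F, F', inGroup1, nodeSet]
    tauto
  · ext (⟨b, j⟩ | ⟨⟨p, q⟩, hp⟩ | b | q | ⟨⟨p, q⟩, hp⟩) <;> simp [blueSet, T, F, nodeSet]
    · grind
    · tauto
  · ext (⟨b, j⟩ | ⟨⟨p, q⟩, hp⟩ | b | q | ⟨⟨p, q⟩, hp⟩) <;>
      simp [doneSet, T, inGroup1, nodeSet] <;> tauto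

set_option maxHeartbeats 1000000 in
theorem Reach.second_level [DecidableRel adj] (hk : N < k) (hirr : ∀ a, ¬ adj a a)
    {L P₁ P₂ : Set (Fin N)} {n : ℕ} {a : Fin N}
    (h : Reach (vcEdge N k adj) (k + 1) (commonSet k adj a) (blueSet k adj L P₁ P₂)
      (doneSet k adj P₁ P₂) n) (ha : a ∉ P₂) (hP₁ : ∀ b, adj a b → b ∈ P₁) :
    Reach (vcEdge N k adj) (k + 1) ∅ (blueSet k adj L P₁ (insert a P₂))
      (doneSet k adj P₁ (insert a P₂)) (n + N) := by
  have hcard := ncard_inGroup2_le hk hirr a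
  let I : Set (VCNode N k adj) := nodeSet k adj (fun _ => False) (fun b c => c = a ∧ adj a b)
    (fun _ => False) (fun _ => False) (fun _ => False)
  let F : Set (VCNode N k adj) := nodeSet k adj (fun _ => False) (fun _ _ => False)
    (fun _ => False) (fun _ => False) (· = a)
  let U : Set (VCNode N k adj) := nodeSet k adj (fun _ => False) (fun _ _ => False)
    (· = a) (fun _ => False) (fun _ => False)
  have hIU : I.ncard + U.ncard ≤ N := by
    rw [← Set.ncard_union_eq]
    · refine (ncard_le_of_subset_range (fun b : Fin N => if h : b ≠ a then
        Sum.inr (Sum.inl ⟨(b, a), h⟩) else Sum.inr (Sum.inr (Sum.inl a))) ?_).trans_eq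
        (Fintype.card_fin _)
      rintro (⟨b, j⟩ | ⟨⟨p, q⟩, hp⟩ | b | ⟨p, q⟩ | ⟨⟨p, q⟩, hp⟩) h <;>
        simp only [I, U, nodeSet, Set.mem_union, Set.mem_ofPred_eq, or_false, false_or] at h
      · obtain ⟨rfl, h⟩ := h
        exact ⟨p, by simp_all⟩
      · subst h
        exact ⟨b, by simp⟩
    · refine Set.disjoint_left.2 ?_
      rintro (⟨b, j⟩ | ⟨⟨p, q⟩, hp⟩ | b | q | ⟨⟨p, q⟩, hp⟩) <;> simp [I, U, nodeSet]
  have hgroup : commonSet k adj a ∪ I ∪ F = {v | inGroup2 a v} := by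
    ext (⟨b, j⟩ | ⟨⟨p, q⟩, hp⟩ | b | q | ⟨⟨p, q⟩, hp⟩) <;>
      simp [commonSet, I, F, inGroup2, nodeSet]
  have h₁ := h.load I
    (by
      rintro (⟨b, j⟩ | ⟨⟨p, q⟩, hp⟩ | b | q | ⟨⟨p, q⟩, hp⟩) <;>
        simp +contextual [I, blueSet, nodeSet, ha, hP₁])
    (by
      have := Set.ncard_le_ncard (Set.subset_union_left (s := commonSet k adj a ∪ I) (t := F))
      rw [hgroup] at this
      omega)
  have h₂ := h₁.compute F
    (by
      refine Set.disjoint_left.2 ?_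
      rintro (⟨b, j⟩ | ⟨⟨p, q⟩, hp⟩ | b | q | ⟨⟨p, q⟩, hp⟩) <;>
        simp +contextual [F, doneSet, nodeSet, ha])
    (by
      refine Set.disjoint_left.2 ?_
      rintro (⟨b, j⟩ | ⟨⟨p, q⟩, hp⟩ | b | q | ⟨⟨p, q⟩, hp⟩) <;> simp [F, blueSet, nodeSet])
    (by
      rintro (⟨b, j⟩ | ⟨⟨p, q⟩, hp⟩ | b | q | ⟨⟨p, q⟩, hp⟩) <;> simp [F, nodeSet, vcEdge])
    (by rw [hgroup]; omega)
  rw [hgroup] at h₂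
  have h₃ := h₂.compute_store U
    (by
      refine Set.disjoint_left.2 ?_
      rintro (⟨b, j⟩ | ⟨⟨p, q⟩, hp⟩ | b | q | ⟨⟨p, q⟩, hp⟩) <;>
        simp +contextual [U, F, doneSet, nodeSet, ha])
    (by
      refine Set.disjoint_left.2 ?_
      rintro (⟨b, j⟩ | ⟨⟨p, q⟩, hp⟩ | b | q | ⟨⟨p, q⟩, hp⟩) <;>
        simp +contextual [U, I, blueSet, nodeSet, ha])
    (by
      refine Set.disjoint_left.2 ?_
      rintro (⟨b, j⟩ | ⟨⟨p, q⟩, hp⟩ | b | q | ⟨⟨p, q⟩, hp⟩) <;> simp [U, inGroup2, nodeSet])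
    (by
      rintro (⟨b, j⟩ | ⟨⟨p, q⟩, hp⟩ | b | q | ⟨⟨p, q⟩, hp⟩) <;>
        simp +contextual [U, nodeSet, vcEdge])
    (by omega)
  have h₄ := h₃.delete _ subset_rfl
  rw [Set.sdiff_self] at h₄
  convert h₄.mono (m := n + N) (by omega) using 1
  · ext (⟨b, j⟩ | ⟨⟨p, q⟩, hp⟩ | b | q | ⟨⟨p, q⟩, hp⟩) <;> simp [blueSet, U, I, nodeSet]
    · grind
    · tauto
  · ext (⟨b, j⟩ | ⟨⟨p, q⟩, hp⟩ | b | q | ⟨⟨p, q⟩, hp⟩) <;>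
      simp [doneSet, U, F, nodeSet] <;> tauto

theorem Reach.store_common [DecidableRel adj] {R n : ℕ} {L P₁ P₂ : Set (Fin N)}
    {D : Set (VCNode N k adj)} {a : Fin N}
    (h : Reach (vcEdge N k adj) R (commonSet k adj a) (blueSet k adj L P₁ P₂) D n) :
    Reach (vcEdge N k adj) R ∅ (blueSet k adj (insert a L) P₁ P₂) D (n + (k - N)) := by
  have hcard := ncard_commonSet_le (k := k) (adj := adj) a
  have h₁ := h.store _ subset_rfl
  rw [Set.sdiff_self] at h₁
  convert h₁.mono (m := n + (k - N)) (by omega) using 1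
  ext (⟨b, j⟩ | ⟨⟨p, q⟩, hp⟩ | b | q | ⟨⟨p, q⟩, hp⟩) <;>
    simp [blueSet, commonSet, nodeSet]
  tauto

theorem Reach.load_common [DecidableRel adj] {R n : ℕ} (hR : k ≤ R) {L P₁ P₂ : Set (Fin N)}
    {D : Set (VCNode N k adj)} {a : Fin N} (ha : a ∈ L)
    (h : Reach (vcEdge N k adj) R ∅ (blueSet k adj L P₁ P₂) D n) :
    Reach (vcEdge N k adj) R (commonSet k adj a) (blueSet k adj (L \ {a}) P₁ P₂) D
      (n + (k - N)) := by
  have hcard := ncard_commonSet_le (k := k) (adj := adj) a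
  have h₁ := h.load (commonSet k adj a)
    (by
      rintro (⟨b, j⟩ | ⟨⟨p, q⟩, hp⟩ | b | q | ⟨⟨p, q⟩, hp⟩) <;>
        simp +contextual [commonSet, blueSet, nodeSet, ha])
    (by rw [Set.empty_union]; omega)
  rw [Set.empty_union] at h₁
  convert h₁.mono (m := n + (k - N)) (by omega) using 1
  ext (⟨b, j⟩ | ⟨⟨p, q⟩, hp⟩ | b | q | ⟨⟨p, q⟩, hp⟩) <;>
    simp [blueSet, commonSet, nodeSet]

theorem reach_first_level [DecidableRel adj] (hk : N < k) (P : Finset (Fin N)) :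
    Reach (vcEdge N k adj) (k + 1) ∅ (blueSet k adj P P ∅) (doneSet k adj P ∅) (P.card * k) := by
  induction P using Finset.induction_on with
  | empty =>
    convert Reach.empty (vcEdge N k adj) (k + 1) using 1
    · ext (⟨b, j⟩ | ⟨⟨p, q⟩, hp⟩ | b | q | ⟨⟨p, q⟩, hp⟩) <;> simp [blueSet, nodeSet]
    · ext (⟨b, j⟩ | ⟨⟨p, q⟩, hp⟩ | b | q | ⟨⟨p, q⟩, hp⟩) <;> simp [doneSet, nodeSet]
    · simp
  | insert a P ha ih =>
    rw [Finset.card_insert_of_notMem ha, add_mul, Finset.coe_insert]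
    exact ((ih.first_level hk (by simpa) (by simpa) (by simp)).store_common).mono (by omega)

theorem reach_both_levels [DecidableRel adj] (hk : N < k) (hirr : ∀ a, ¬ adj a a)
    {S : Finset (Fin N)} (hS : IsVertexCover adj S) {P : Finset (Fin N)} (hP : Disjoint P S) :
    Reach (vcEdge N k adj) (k + 1) ∅ (blueSet k adj S (P ∪ S) P) (doneSet k adj (P ∪ S) P)
      (S.card * k + P.card * (2 * N)) := by
  induction P using Finset.induction_on with
  | empty => simpa using reach_first_level hk S
  | insert a P ha ih =>
    rw [Finset.disjoint_insert_left] at hP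
    rw [Finset.card_insert_of_notMem ha, add_mul, Finset.coe_insert, Set.insert_union]
    refine (((ih hP.2).first_level hk (by simpa using hP.1) (by simp [ha, hP.1])
      fun b hb hba => ?_).second_level hk hirr (by simpa) fun b hab => ?_).mono (by omega)
    · exact (hS b a hba).elim (Finset.disjoint_left.1 hP.2 hb) hP.1
    · exact Or.inr (Or.inr ((hS a b hab).resolve_left hP.1))

theorem reach_second_level [DecidableRel adj] (hk : N < k) (hirr : ∀ a, ¬ adj a a)
    {S : Finset (Fin N)} (hS : IsVertexCover adj S) {P : Finset (Fin N)} (hP : P ⊆ S) :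
    Reach (vcEdge N k adj) (k + 1) ∅ (blueSet k adj (S \ P) Set.univ (P ∪ (S : Set (Fin N))ᶜ))
      (doneSet k adj Set.univ (P ∪ (S : Set (Fin N))ᶜ))
      (S.card * k + Sᶜ.card * (2 * N) + P.card * k) := by
  induction P using Finset.induction_on with
  | empty => simpa using reach_both_levels hk hirr hS (P := Sᶜ) disjoint_compl_left
  | insert a P ha ih =>
    rw [Finset.insert_subset_iff] at hP
    rw [Finset.card_insert_of_notMem ha, add_mul, Finset.coe_insert, Set.insert_union]
    have := (((ih hP.2).load_common (a := a) (by omega) (by simp [hP.1, ha])).second_level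
      hk hirr (by simp [hP.1, ha]) fun _ _ => trivial).mono
      (m := S.card * k + Sᶜ.card * (2 * N) + (P.card * k + 1 * k)) (by omega)
    rwa [Set.sdiff_sdiff, Set.union_singleton] at this

theorem mem_blueSet_of_isSink {v : VCNode N k adj}
    (hv : IsSink (vcEdge N k adj) v) : v ∈ blueSet k adj ∅ Set.univ Set.univ := by
  obtain ⟨b, j⟩ | ⟨⟨p, q⟩, hp⟩ | b | ⟨p, q⟩ | ⟨⟨p, q⟩, hp⟩ := v
  · exact (hv (Sum.inr (Sum.inr (Sum.inl b))) rfl).elim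
  · exact ⟨trivial, fun h => hv (Sum.inr (Sum.inr (Sum.inl q))) ⟨rfl, h.2⟩⟩
  · trivial
  · refine ⟨?_, trivial⟩
    by_contra hN
    have : Nontrivial (Fin N) := Fin.nontrivial_iff_two_le.2 (by have := p.pos; omega)
    obtain ⟨b, hb⟩ := exists_ne p
    exact hv (Sum.inr (Sum.inl ⟨(p, b), hb.symm⟩)) rfl
  · exact (hv (Sum.inr (Sum.inr (Sum.inl p))) rfl).elim

theorem exists_isVertexCover_card_eq_vcNumber (adj : Fin N → Fin N → Prop) :
    ∃ S : Finset (Fin N), IsVertexCover adj S ∧ S.card = vcNumber adj :=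
  Nat.sInf_mem (s := {m | ∃ S : Finset (Fin N), IsVertexCover adj S ∧ S.card = m})
    ⟨_, Finset.univ, fun a _ _ => Or.inl (Finset.mem_univ a), rfl⟩

end VertexCoverDAG

/-- For an undirected graph `G` on `N` vertices and `k > N`, the
vertex-cover DAG `P(G,k)` admits a valid pebbling with `R = k + 1` red pebbles
in the oneshot model of cost at most `2·(k − N)·τ(G) + 2N²`. -/
theorem vertex_cover_dag_cost_upper_bound
    (N k : ℕ) (hk : N < k) (adj : Fin N → Fin N → Prop) [DecidableRel adj]
    (hsymm : Symmetric adj) (hirr : Irreflexive adj) :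
    ∃ moves : List (Move (VCNode N k adj)),
      IsPebbling (vcEdge N k adj) (k + 1) moves ∧ Oneshot moves ∧
        cost moves ≤ 2 * (k - N) * vcNumber adj + 2 * N ^ 2 := by
  obtain ⟨S, hS, hcard⟩ := exists_isVertexCover_card_eq_vcNumber adj
  obtain ⟨ms, h1, -, h3, h4, -, h6⟩ := reach_second_level hk hirr hS subset_rfl
  rw [Set.sdiff_self, Set.union_compl_self] at h3
  refine ⟨ms, ⟨h1, fun v hv => ?_⟩, h4, h6.trans ?_⟩
  · simp [(h3 v).2 (mem_blueSet_of_isSink hv)]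
  · rw [← hcard]
    have hSc : S.card + Sᶜ.card = N := by simp [Finset.card_add_card_compl]
    obtain ⟨d, rfl⟩ := Nat.exists_eq_add_of_lt hk
    have hd : N + d + 1 - N = d + 1 := by omega
    rw [hd]
    have hSN : S.card * N + Sᶜ.card * N = N ^ 2 := by rw [← add_mul, hSc, sq]
    nlinarith

end RBPebble
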